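/- arXiv:2012.02630 — 5 statements merged into one kernel-verified Lean document; each statement's English description precedes it below -/
import Mathlib

section
/- For all natural numbers n and d with 0 < d and 2*d ≤ n, setting r = n/d (as a real number), the binomial coefficient satisfies log₂ (n choose d) ≥ d · ( log₂ r + (r − 1) · log₂ ( r / (r − 1) ) ) − (1/2) · log₂ d − 3/2. -/
open Real

/-- The sequence `log n! + n - n log n` is nondecreasing in `n`. -/
lemma monotone_log_factorial_add_sub_mul_log :
    Monotone fun n : ℕ => Real.log (n.factorial : ℝ) + n - n * Real.log n := by
  refine monotone_nat_of_le_succ fun n => ?_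
  rcases Nat.eq_zero_or_pos n with rfl | hn
  · simp
  have hn' : (0 : ℝ) < n := by exact_mod_cast hn
  have hstep : n * (Real.log (n + 1) - Real.log n) ≤ 1 := by
    rw [← Real.log_div (by positivity) hn'.ne']
    have h := Real.log_le_sub_one_of_pos (show (0 : ℝ) < (n + 1) / n by positivity)
    calc n * Real.log ((n + 1) / n) ≤ n * (((n : ℝ) + 1) / n - 1) := by gcongr
      _ = 1 := by field_simp; ring
  rw [Nat.factorial_succ]
  push_cast
  rw [Real.log_mul (by positivity) (by positivity)]
  linarith

lemma log_factorial_le_stirling_add_one {d : ℕ} (hd : 0 < d) :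
    Real.log (d.factorial : ℝ) ≤ d * Real.log d - d + Real.log d / 2 + 1 := by
  obtain ⟨k, rfl⟩ := Nat.exists_eq_succ_of_ne_zero hd.ne'
  have hk : (0 : ℝ) < (k.succ : ℝ) := by positivity
  have h := Stirling.log_stirlingSeq'_antitone (Nat.zero_le k)
  simp only [Function.comp_apply, Stirling.log_stirlingSeq_formula] at h
  rw [Real.log_mul two_ne_zero hk.ne', Real.log_div hk.ne' (Real.exp_pos 1).ne',
    Real.log_exp] at h
  norm_num at h
  push_cast at h ⊢
  linarith

theorem stirling_binom_lower_bound (n d : ℕ) (hd : 0 < d) (hdn : 2 * d ≤ n) :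
    Real.logb 2 (n.choose d) ≥
      (d : ℝ) * (Real.logb 2 ((n : ℝ) / d) +
        ((n : ℝ) / d - 1) * Real.logb 2 (((n : ℝ) / d) / ((n : ℝ) / d - 1)))
      - (1 / 2) * Real.logb 2 d - 3 / 2 := by
  obtain ⟨m, rfl⟩ : ∃ m, n = d + m := ⟨n - d, by omega⟩
  have hm : 0 < m := by omega
  have hd' : (0 : ℝ) < d := by exact_mod_cast hd
  have hm' : (0 : ℝ) < m := by exact_mod_cast hm
  have hmono := monotone_log_factorial_add_sub_mul_log (Nat.le_add_left m d)
  have hfac := log_factorial_le_stirling_add_one hd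
  have hchoose : Real.log ((d + m).choose d : ℝ) + Real.log (d.factorial : ℝ)
      + Real.log (m.factorial : ℝ) = Real.log ((d + m).factorial : ℝ) := by
    have hpos : (0 : ℝ) < (d + m).choose d := by
      exact_mod_cast Nat.choose_pos (Nat.le_add_right d m)
    rw [← Real.log_mul hpos.ne' (by positivity), ← Real.log_mul (by positivity) (by positivity)]
    congr 1
    have h := Nat.choose_mul_factorial_mul_factorial (Nat.le_add_right d m)
    rw [Nat.add_sub_cancel_left] at h
    exact_mod_cast h
  have hr : ((d + m : ℕ) : ℝ) / d - 1 = m / d := by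
    push_cast
    field_simp
    ring
  have hq : ((d + m : ℕ) : ℝ) / d / (m / d) = ((d + m : ℕ) : ℝ) / m := by
    field_simp
  have hlog2 : 0 < Real.log 2 := Real.log_pos one_lt_two
  have hlog2' := Real.log_two_gt_d9
  have hn' : ((d + m : ℕ) : ℝ) ≠ 0 := by positivity
  rw [hr, hq, ge_iff_le]
  simp only [Real.logb]
  rw [Real.log_div hn' hd'.ne', Real.log_div hn' hm'.ne', le_div_iff₀ hlog2]
  have hexpand : ((d : ℝ) * ((Real.log ((d + m : ℕ) : ℝ) - Real.log d) / Real.log 2 +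
      m / d * ((Real.log ((d + m : ℕ) : ℝ) - Real.log m) / Real.log 2))
      - 1 / 2 * (Real.log d / Real.log 2) - 3 / 2) * Real.log 2 =
      (d + m) * Real.log ((d + m : ℕ) : ℝ) - d * Real.log d - m * Real.log m
      - Real.log d / 2 - 3 / 2 * Real.log 2 := by
    field_simp
    ring
  rw [hexpand]
  push_cast at hmono hchoose ⊢
  linarith
end

section
/- Let h(p) = −p · log₂ p − (1 − p) · log₂ (1 − p) denote the binary entropy function (with logarithm to base 2). Then the function f(p) = (1 + p) / ( h(p) + 0.255 · p ) is non-increasing on the interval (0, 0.4); that is, for all real numbers p, q with 0 < p ≤ q < 0.4, we have (1 + q) / ( h(q) + 0.255 · q ) ≤ (1 + p) / ( h(p) + 0.255 · p ). -/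
open Real

/-- Gibbs' inequality for two-point distributions. -/
lemma binEntropy_le_crossEntropy {p q : ℝ} (hp : 0 < p) (hp1 : p < 1) (hq : 0 < q) (hq1 : q < 1) :
    binEntropy p ≤ -p * log q - (1 - p) * log (1 - q) := by
  have key : ∀ {a b : ℝ}, 0 < a → 0 < b → a * (log b - log a) ≤ b - a := by
    intro a b ha hb
    rw [← log_div hb.ne' ha.ne']
    calc a * log (b / a) ≤ a * (b / a - 1) :=
          mul_le_mul_of_nonneg_left (log_le_sub_one_of_pos (div_pos hb ha)) ha.le
      _ = b - a := by field_simp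
  have h1 := key hp hq
  have h2 := key (sub_pos.2 hp1) (sub_pos.2 hq1)
  rw [binEntropy, log_inv, log_inv]
  linarith

lemma two_mul_log_one_sub_sub_log_nonneg {q : ℝ} (hq : 0 < q) (hq' : q < 0.4) :
    0 ≤ 2 * log (1 - q) - log q + 0.255 * log 2 := by
  have h1 : log 0.6 ≤ log (1 - q) := log_le_log (by norm_num) (by linarith)
  have h2 : log q ≤ log 0.4 := log_le_log hq hq'.le
  have h3 : 2 * log 0.6 - log 0.4 = log (0.9 : ℝ) := by
    rw [two_mul, ← log_mul (by norm_num) (by norm_num), ← log_div (by norm_num) (by norm_num)]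
    norm_num
  have h4 := one_sub_inv_le_log_of_pos (show (0 : ℝ) < 0.9 by norm_num)
  have h5 := log_two_gt_d9
  norm_num at h1 h2 h3 h4 h5 ⊢
  linarith

theorem f_nonincreasing (p q : ℝ) (hp : 0 < p) (hpq : p ≤ q) (hq : q < 0.4) :
    (1 + q) / ((-q * Real.logb 2 q - (1 - q) * Real.logb 2 (1 - q)) + 0.255 * q) ≤
      (1 + p) / ((-p * Real.logb 2 p - (1 - p) * Real.logb 2 (1 - p)) + 0.255 * p) := by
  have hq0 : 0 < q := hp.trans_le hpq
  have hq1 : q < 1 := hq.trans (by norm_num)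
  have hp1 : p < 1 := hpq.trans_lt hq1
  have hl : 0 < log 2 := log_pos one_lt_two
  have entropy_eq (x : ℝ) : -x * logb 2 x - (1 - x) * logb 2 (1 - x) + 0.255 * x =
      (binEntropy x + 0.255 * log 2 * x) / log 2 := by
    rw [binEntropy, log_inv, log_inv, logb, logb]
    field_simp
    ring
  have hP : 0 < binEntropy p + 0.255 * log 2 * p :=
    add_pos (binEntropy_pos hp hp1) (by positivity)
  have hQ : 0 < binEntropy q + 0.255 * log 2 * q :=
    add_pos (binEntropy_pos hq0 hq1) (by positivity)
  rw [entropy_eq, entropy_eq, div_le_div_iff₀ (div_pos hQ hl) (div_pos hP hl),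
    ← mul_div_assoc, ← mul_div_assoc]
  refine div_le_div_of_nonneg_right ?_ hl.le
  have gibbs := mul_le_mul_of_nonneg_left
    (binEntropy_le_crossEntropy hp hp1 hq0 hq1) (by linarith : 0 ≤ 1 + q)
  have slope := mul_nonneg (sub_nonneg.2 hpq) (two_mul_log_one_sub_sub_log_nonneg hq0 hq)
  have hHq : binEntropy q = -q * log q - (1 - q) * log (1 - q) := by
    rw [binEntropy, log_inv, log_inv]
    ring
  rw [hHq]
  linarith
end

section
/- Let h(p) = −p · log₂ p − (1 − p) · log₂ (1 − p) denote the binary entropy function (with logarithm to base 2). Then ( 1 + 16/43 ) / ( h(16/43) + 0.255 · (16/43) ) > 1.31. -/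
open Real

theorem logb_two_three_bounds :
    84 / 53 ≤ Real.logb 2 3 ∧ Real.logb 2 3 ≤ 8 / 5 := by
  have lower : Real.logb 2 ((2 : ℝ) ^ 84) ≤ Real.logb 2 ((3 : ℝ) ^ 53) :=
    Real.logb_le_logb_of_le (by norm_num) (by positivity) (by norm_num)
  have upper : Real.logb 2 ((3 : ℝ) ^ 5) ≤ Real.logb 2 ((2 : ℝ) ^ 8) :=
    Real.logb_le_logb_of_le (by norm_num) (by positivity) (by norm_num)
  have two : Real.logb 2 2 = 1 := Real.logb_self_eq_one (by norm_num)
  rw [Real.logb_pow, Real.logb_pow, two] at lower upper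
  push_cast at lower upper
  constructor <;> linarith

set_option exponentiation.threshold 1000 in
theorem logb_two_forty_three_bounds :
    5 ≤ Real.logb 2 43 ∧ Real.logb 2 43 ≤ 700 / 129 := by
  have lower : Real.logb 2 ((2 : ℝ) ^ 5) ≤ Real.logb 2 43 :=
    Real.logb_le_logb_of_le (by norm_num) (by positivity) (by norm_num)
  have upper : Real.logb 2 ((43 : ℝ) ^ 129) ≤ Real.logb 2 ((2 : ℝ) ^ 700) :=
    Real.logb_le_logb_of_le (by norm_num) (by positivity) (by norm_num)
  have two : Real.logb 2 2 = 1 := Real.logb_self_eq_one (by norm_num)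
  rw [Real.logb_pow, two] at lower
  rw [Real.logb_pow, Real.logb_pow, two] at upper
  push_cast at lower upper
  constructor <;> linarith

theorem f_at_16_43 :
    (1 + 16 / 43) /
      ((-(16 / 43) * Real.logb 2 (16 / 43)
          - (1 - 16 / 43) * Real.logb 2 (1 - 16 / 43)) + 0.255 * (16 / 43)) > (1.31 : ℝ) := by
  obtain ⟨three_lower, three_upper⟩ := logb_two_three_bounds
  obtain ⟨forty_three_lower, forty_three_upper⟩ := logb_two_forty_three_bounds
  have log_p : Real.logb 2 (16 / 43) = 4 - Real.logb 2 43 := by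
    rw [Real.logb_div (by norm_num) (by norm_num), show (16 : ℝ) = 2 ^ 4 by norm_num,
      Real.logb_pow, Real.logb_self_eq_one (by norm_num)]
    norm_num
  have log_q : Real.logb 2 (1 - 16 / 43) = 3 * Real.logb 2 3 - Real.logb 2 43 := by
    rw [show (1 - 16 / 43 : ℝ) = 3 ^ 3 / 43 by norm_num,
      Real.logb_div (by norm_num) (by norm_num), Real.logb_pow]
    norm_num
  rw [log_p, log_q, gt_iff_lt, lt_div_iff₀ (by linarith)]
  linarith
end

section
/- Let h(p) = −p · log₂ p − (1 − p) · log₂ (1 − p) denote the binary entropy function (with logarithm to base 2). Then for every real number p with 0 < p ≤ 16/43, we have ( 1 + p ) / ( h(p) + 0.255 · p ) > 1.31. -/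
open Real

lemma mul_logb_two_gibbs {p q : ℝ} (hp : 0 < p) (hq : 0 < q) :
    -p * Real.logb 2 p ≤ -p * Real.logb 2 q + (q - p) / Real.log 2 := by
  have hlog2 : 0 < Real.log 2 := Real.log_pos one_lt_two
  have hlog := mul_le_mul_of_nonneg_left
    (Real.log_le_sub_one_of_pos (div_pos hq hp)) hp.le
  rw [Real.log_div hq.ne' hp.ne', mul_sub, mul_sub, mul_div_cancel₀ _ hp.ne', mul_one] at hlog
  simp only [Real.logb]
  rw [mul_div_assoc', mul_div_assoc', ← add_div]
  gcongr
  linarith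

/-- The binary entropy lies below each of its tangent lines. -/
lemma binary_entropy_le_cross_entropy {p q : ℝ} (hp : 0 < p) (hp1 : p < 1)
    (hq : 0 < q) (hq1 : q < 1) :
    -p * Real.logb 2 p - (1 - p) * Real.logb 2 (1 - p) ≤
      -p * Real.logb 2 q - (1 - p) * Real.logb 2 (1 - q) := by
  have h₁ := mul_logb_two_gibbs hp hq
  have h₂ := mul_logb_two_gibbs (sub_pos.2 hp1) (sub_pos.2 hq1)
  have h₃ : (1 - q - (1 - p)) / Real.log 2 = -((q - p) / Real.log 2) := by ring
  linarith

lemma div_lt_logb_two {x : ℝ} {m n : ℕ} (hn : 0 < n)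
    (h : (2 : ℝ) ^ m < x ^ n) : (m / n : ℝ) < Real.logb 2 x := by
  have hlog := Real.logb_lt_logb one_lt_two (by positivity) h
  rw [Real.logb_pow, Real.logb_pow, Real.logb_self_eq_one one_lt_two, mul_one] at hlog
  rw [div_lt_iff₀ (by positivity)]
  linarith

theorem f_gt_131 (p : ℝ) (hp : 0 < p) (hp' : p ≤ 16 / 43) :
    (1 + p) / ((-p * Real.logb 2 p - (1 - p) * Real.logb 2 (1 - p)) + 0.255 * p) > 1.31 := by
  have hp1 : p < 1 := by linarith
  have hlog_p : Real.logb 2 p < 0 := Real.logb_neg one_lt_two hp hp1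
  have hlog_sub : Real.logb 2 (1 - p) < 0 :=
    Real.logb_neg one_lt_two (by linarith) (by linarith)
  have hpos : 0 < -p * Real.logb 2 p - (1 - p) * Real.logb 2 (1 - p) + 0.255 * p := by
    nlinarith [mul_pos_of_neg_of_neg (neg_neg_of_pos hp) hlog_p,
      mul_neg_of_pos_of_neg (sub_pos.2 hp1) hlog_sub]
  have hent := binary_entropy_le_cross_entropy (q := 3 / 8) hp hp1 (by norm_num) (by norm_num)
  have h8 : Real.logb 2 8 = 3 := by
    rw [show (8 : ℝ) = 2 ^ 3 by norm_num, Real.logb_pow, Real.logb_self_eq_one one_lt_two]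
    norm_num
  rw [show (1 - 3 / 8 : ℝ) = 5 / 8 by norm_num,
    Real.logb_div (by norm_num) (by norm_num), Real.logb_div (by norm_num) (by norm_num), h8]
    at hent
  have h3 : (84 / 53 : ℝ) < Real.logb 2 3 :=
    div_lt_logb_two (m := 84) (n := 53) (by norm_num) (by norm_num)
  have h5 : (202 / 87 : ℝ) < Real.logb 2 5 :=
    div_lt_logb_two (m := 202) (n := 87) (by norm_num) (by norm_num)
  have h3' := mul_lt_mul_of_pos_left h3 hp
  have h5' := mul_lt_mul_of_pos_left h5 (sub_pos.2 hp1)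
  rw [gt_iff_lt, lt_div_iff₀ hpos]
  linarith
end

section
/- For every real number B > 0 there exist a real number ε > 0 and a natural number N such that for all natural numbers n ≥ N and all natural numbers d with 1 ≤ d ≤ ε · n, we have (n : ℝ) + d ≥ B · ( log₂ (n choose d) + 0.255 · d + (1/2) · log₂ d + 6.5 ). -/
open Real

/-- Comparing the binomial coefficient with the binomial expansion of `(1 + exp (-L)) ^ n`. -/
lemma log_choose_le (n d : ℕ) {L : ℝ} (hL : 0 ≤ L) :
    Real.log (n.choose d) ≤ n * Real.exp (-L) + d * L := by
  rcases lt_or_ge n d with h | h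
  · rw [Nat.choose_eq_zero_of_lt h, Nat.cast_zero, Real.log_zero]
    positivity
  · have hterm : Real.exp (-L) ^ d * (n.choose d : ℝ) ≤ (Real.exp (-L) + 1) ^ n := by
      rw [add_pow]
      refine le_trans (by simp) (Finset.single_le_sum
        (f := fun m => Real.exp (-L) ^ m * 1 ^ (n - m) * (n.choose m : ℝ))
        (fun i _ => by positivity) (Finset.mem_range.mpr (Nat.lt_succ_of_le h)))
    have hexp : (Real.exp (-L) + 1) ^ n ≤ Real.exp (n * Real.exp (-L)) := by
      rw [Real.exp_nat_mul]
      gcongr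
      exact Real.add_one_le_exp _
    have hpos : (0 : ℝ) < n.choose d := by exact_mod_cast Nat.choose_pos h
    have hlog := Real.log_le_log (by positivity) (hterm.trans hexp)
    rw [Real.log_exp, Real.log_mul (by positivity) hpos.ne', Real.log_pow, Real.log_exp] at hlog
    linarith

lemma logb_two_le_of_log_le {x y : ℝ} (hy : 0 ≤ y) (h : Real.log x ≤ y) :
    Real.logb 2 x ≤ 2 * y := by
  have h2 := Real.log_two_gt_d9
  rw [Real.logb, div_le_iff₀ (by linarith)]
  nlinarith

theorem small_fraction_bound (B : ℝ) (hB : 0 < B) :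
    ∃ ε : ℝ, 0 < ε ∧ ∃ N : ℕ, ∀ n : ℕ, N ≤ n → ∀ d : ℕ, 1 ≤ d → (d : ℝ) ≤ ε * n →
      (n : ℝ) + d ≥
        B * (Real.logb 2 (n.choose d) + 0.255 * d + (1 / 2) * Real.logb 2 d + 6.5) := by
  refine ⟨1 / (4 * B * (16 * B + 2)), by positivity, ⌈26 * B⌉₊, fun n hn d hd hdn => ?_⟩
  have hn' : 26 * B ≤ n := Nat.ceil_le.mp hn
  have hd' : (1 : ℝ) ≤ d := by exact_mod_cast hd
  have hchoose := logb_two_le_of_log_le (by positivity)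
    (log_choose_le n d (L := 8 * B) (by positivity))
  have hlogd := logb_two_le_of_log_le (x := d) (y := d) (by positivity)
    (Real.log_le_self (by positivity))
  have hexp : 8 * B * Real.exp (-(8 * B)) ≤ 1 := by
    rw [Real.exp_neg, ← div_eq_mul_inv, div_le_one (Real.exp_pos _)]
    linarith [Real.add_one_le_exp (8 * B)]
  have hexp_n := mul_le_mul_of_nonneg_right hexp (Nat.cast_nonneg (α := ℝ) n)
  have hd_n : d * (4 * B * (16 * B + 2)) ≤ (n : ℝ) := by
    rwa [one_div, inv_mul_eq_div, le_div_iff₀ (by positivity)] at hdn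
  calc B * (Real.logb 2 (n.choose d) + 0.255 * d + (1 / 2) * Real.logb 2 d + 6.5)
      ≤ B * (2 * (n * Real.exp (-(8 * B)) + d * (8 * B)) + 0.255 * d + (1 / 2) * (2 * d)
          + 6.5) := by gcongr
    _ ≤ (n : ℝ) + d := by nlinarith [mul_pos hB (by linarith : (0 : ℝ) < d)]
end
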